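/- Let (Q,R) be a gentle presentation. The kernel of the differential d^0 : k(Γ_0∥B) → k(Γ_1∥B) of the complex k(Γ∥B) is freely generated by: (i) the element 𝟙 = Σ_{i∈Q_0} (e_i,e_i); (ii) the pairs (s(α),α) with α a B-maximal path; and (iii) the elements ⟨α⟩ = Σ_{i=0}^{r−1} (s(rot^i(α)), rot^i(α)) with α ∈ Crep(B) and r the period of α. (The paper identifies this kernel with the Hochschild cohomology HH^0(kQ/⟨R⟩).) -/

import Mathlib

/-!
Common framework: quivers, paths (as a start vertex together with a list of
composable arrows, listed in order of traversal, so that the paper's path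
`c_m ⋯ c_1` corresponds to the list `[c_1, …, c_m]`), gentle and quadratic
monomial presentations, the cochain complex `k(Γ ∥ B)` and the chain complex
`k(B ⊙ Γ)` of the paper.
-/

namespace GentleTT

structure Quiv where
  V : Type
  A : Type
  [fintV : Fintype V]
  [fintA : Fintype A]
  [decV : DecidableEq V]
  [decA : DecidableEq A]
  src : A → V
  tgt : A → V

attribute [instance] Quiv.fintV Quiv.fintA Quiv.decV Quiv.decA

/-- A "path datum": a start vertex together with the list of arrows traversed. -/
abbrev PathDat (Q : Quiv) := Q.V × List Q.A

def psrc (Q : Quiv) (p : PathDat Q) : Q.V := p.1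

def ptgt (Q : Quiv) (p : PathDat Q) : Q.V := p.2.getLast?.elim p.1 Q.tgt

def plen (Q : Quiv) (p : PathDat Q) : ℕ := p.2.length

/-- `p` is a genuine path: consecutive arrows compose, and the recorded start
vertex is the source of the first arrow (if any). -/
def Ok (Q : Quiv) (p : PathDat Q) : Prop :=
  p.2.Chain' (fun a b => Q.tgt a = Q.src b) ∧ ∀ a ∈ p.2.head?, Q.src a = p.1

/-- `p` is a path none of whose length-2 subpaths lies in `R`
(an element of the basis `B` of `kQ/⟨R⟩`). -/
def InB (Q : Quiv) (R : Set (Q.A × Q.A)) (p : PathDat Q) : Prop :=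
  Ok Q p ∧ p.2.Chain' (fun a b => (a, b) ∉ R)

/-- `p` is a path all of whose length-2 subpaths lie in `R` (an element of `Γ`). -/
def InG (Q : Quiv) (R : Set (Q.A × Q.A)) (p : PathDat Q) : Prop :=
  Ok Q p ∧ p.2.Chain' (fun a b => (a, b) ∈ R)

/-- Parallel paths: same source and same target. -/
def Par (Q : Quiv) (p q : PathDat Q) : Prop :=
  psrc Q p = psrc Q q ∧ ptgt Q p = ptgt Q q

/-- Antiparallel paths: `s(p) = t(q)` and `t(p) = s(q)`. -/
def AntiPar (Q : Quiv) (p q : PathDat Q) : Prop :=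
  psrc Q p = ptgt Q q ∧ ptgt Q p = psrc Q q

/-- A cycle: a path of positive length whose source equals its target. -/
def IsCycle (Q : Quiv) (p : PathDat Q) : Prop :=
  Ok Q p ∧ p.2 ≠ [] ∧ psrc Q p = ptgt Q p

/-- Rotation of a cycle: the paper's `rot (c_m ⋯ c_1) = c_{m-1} ⋯ c_1 c_m`
(the last arrow traversed becomes the first one traversed). -/
def rotP (Q : Quiv) (p : PathDat Q) : PathDat Q :=
  match p.2.getLast? with
  | none => p
  | some a => (Q.src a, a :: p.2.dropLast)

/-- Iterated rotation `rot^i`. -/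
def rotI (Q : Quiv) (i : ℕ) (p : PathDat Q) : PathDat Q := (rotP Q)^[i] p

def powL {α : Type} (l : List α) : ℕ → List α
  | 0 => []
  | n + 1 => l ++ powL l n

/-- The `n`-th power `p^n` of a (cyclic) path. -/
def powP (Q : Quiv) (p : PathDat Q) (n : ℕ) : PathDat Q := (p.1, powL p.2 n)

/-- A primitive cycle: a cycle that is not a proper power of another cycle. -/
def IsPrimitive (Q : Quiv) (p : PathDat Q) : Prop :=
  IsCycle Q p ∧ ∀ (q : PathDat Q) (n : ℕ), IsCycle Q q → 2 ≤ n → p ≠ powP Q q n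

/-- The period of a cycle: the least `i ≥ 1` with `rot^i p = p`. -/
noncomputable def periodP (Q : Quiv) (p : PathDat Q) : ℕ :=
  sInf {i : ℕ | 1 ≤ i ∧ rotI Q i p = p}

/-- Two cycles are conjugate (belong to the same circuit) if one is obtained
from the other by iterated rotation. -/
def RotEquiv (Q : Quiv) (p q : PathDat Q) : Prop := ∃ i : ℕ, rotI Q i p = q

/-- A cocomplete cycle: `p² ∈ B`. -/
def Cocomplete (Q : Quiv) (R : Set (Q.A × Q.A)) (p : PathDat Q) : Prop :=
  IsCycle Q p ∧ InB Q R (powP Q p 2)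

/-- A complete cycle: `p² ∈ Γ`. -/
def Complete (Q : Quiv) (R : Set (Q.A × Q.A)) (p : PathDat Q) : Prop :=
  IsCycle Q p ∧ InG Q R (powP Q p 2)

/-- `B`-maximal path: in `B` and not a proper subpath of another element of `B`. -/
def BMax (Q : Quiv) (R : Set (Q.A × Q.A)) (p : PathDat Q) : Prop :=
  InB Q R p ∧ ∀ q : PathDat Q, InB Q R q → p.2 <:+: q.2 → p.2 = q.2

/-- `Γ`-maximal path: in `Γ` and not a proper subpath of another element of `Γ`. -/
def GMax (Q : Quiv) (R : Set (Q.A × Q.A)) (p : PathDat Q) : Prop :=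
  InG Q R p ∧ ∀ q : PathDat Q, InG Q R q → p.2 <:+: q.2 → p.2 = q.2

def Adj (Q : Quiv) (v w : Q.V) : Prop :=
  ∃ a : Q.A, (Q.src a = v ∧ Q.tgt a = w) ∨ (Q.src a = w ∧ Q.tgt a = v)

/-- Connectedness of the underlying graph of the quiver. -/
def Connected (Q : Quiv) : Prop := ∀ v w : Q.V, Relation.ReflTransGen (Adj Q) v w

/-- A quadratic monomial presentation: the relations are paths of length 2. -/
def IsQuadMon (Q : Quiv) (R : Set (Q.A × Q.A)) : Prop :=
  ∀ r ∈ R, Q.tgt r.1 = Q.src r.2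

/-- A gentle presentation. -/
structure IsGentle (Q : Quiv) (R : Set (Q.A × Q.A)) : Prop where
  nonempty : Nonempty Q.V
  connected : Connected Q
  relComposable : ∀ r ∈ R, Q.tgt r.1 = Q.src r.2
  srcLe : ∀ v : Q.V, {a : Q.A | Q.src a = v}.ncard ≤ 2
  tgtLe : ∀ v : Q.V, {a : Q.A | Q.tgt a = v}.ncard ≤ 2
  uniqNotRelAfter : ∀ a : Q.A, {b : Q.A | Q.tgt a = Q.src b ∧ (a, b) ∉ R}.Subsingleton
  uniqNotRelBefore : ∀ a : Q.A, {c : Q.A | Q.tgt c = Q.src a ∧ (c, a) ∉ R}.Subsingleton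
  uniqRelAfter : ∀ a : Q.A, {b : Q.A | Q.tgt a = Q.src b ∧ (a, b) ∈ R}.Subsingleton
  uniqRelBefore : ∀ a : Q.A, {c : Q.A | Q.tgt c = Q.src a ∧ (c, a) ∈ R}.Subsingleton

/-- A spanning tree of the (finite, connected) quiver `Q`: a set of arrows
which connects all vertices and has exactly `|Q₀| - 1` elements. -/
def IsSpanningTree (Q : Quiv) (T : Set Q.A) : Prop :=
  (∀ v w : Q.V, Relation.ReflTransGen
      (fun x y => ∃ a ∈ T, (Q.src a = x ∧ Q.tgt a = y) ∨ (Q.src a = y ∧ Q.tgt a = x)) v w) ∧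
  T.ncard + 1 = Fintype.card Q.V

/-- A set of representatives, one for each rotation class of cycles
satisfying `Pred`. -/
def IsRepSet (Q : Quiv) (P : Set (PathDat Q)) (Pred : PathDat Q → Prop) : Prop :=
  (∀ p ∈ P, Pred p) ∧ ∀ q : PathDat Q, Pred q → ∃! p, p ∈ P ∧ RotEquiv Q q p

/-- `S` is a valid choice of the paper's set `Crep` for the predicate `Pred`
(e.g. cocompleteness, or completeness): it consists of all positive powers of a
chosen set of representatives of the rotation classes of primitive cycles
satisfying `Pred`. -/
def IsCrep (Q : Quiv) (S : Set (PathDat Q)) (Pred : PathDat Q → Prop) : Prop :=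
  ∃ P : Set (PathDat Q),
    IsRepSet Q P (fun p => IsPrimitive Q p ∧ Pred p) ∧
    S = {x | ∃ p ∈ P, ∃ n : ℕ, 1 ≤ n ∧ x = powP Q p n}

/-! ### The cochain complex `k(Γ ∥ B)` -/

/-- Membership in the degree-`m` basis `Γ_m ∥ B` of the cochain complex. -/
def GBmem (Q : Quiv) (R : Set (Q.A × Q.A)) (m : ℕ) (x : PathDat Q × PathDat Q) : Prop :=
  InG Q R x.1 ∧ plen Q x.1 = m ∧ InB Q R x.2 ∧ Par Q x.1 x.2

abbrev GB (Q : Quiv) (R : Set (Q.A × Q.A)) (m : ℕ) :=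
  {x : PathDat Q × PathDat Q // GBmem Q R m x}

/-- The degree-`m` component of the cochain complex `k(Γ ∥ B)`. -/
abbrev Coch (k : Type) [Field k] (Q : Quiv) (R : Set (Q.A × Q.A)) (m : ℕ) :=
  GB Q R m →₀ k

/-- The basis vector of `k(Γ_m ∥ B)` attached to a raw pair of path data
(and `0` if the pair is not in `Γ_m ∥ B`). -/
noncomputable def bv (k : Type) [Field k] (Q : Quiv) (R : Set (Q.A × Q.A)) (m : ℕ)
    (x : PathDat Q × PathDat Q) : Coch k Q R m := by
  classical
  exact if h : GBmem Q R m x then Finsupp.single (⟨x, h⟩ : GB Q R m) (1 : k) else 0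

/-- Extension on the left (in the paper's notation): `p ↦ b p`. -/
def extL (Q : Quiv) (b : Q.A) (p : PathDat Q) : PathDat Q := (p.1, p.2 ++ [b])

/-- Extension on the right (in the paper's notation): `p ↦ p a`. -/
def extR (Q : Quiv) (a : Q.A) (p : PathDat Q) : PathDat Q := (Q.src a, a :: p.2)

/-- The differential on a basis element:
`d^m (γ, α) = Σ_b (bγ, bα) - (-1)^m Σ_a (γa, αa)`. -/
noncomputable def dB (k : Type) [Field k] (Q : Quiv) (R : Set (Q.A × Q.A)) (m : ℕ)
    (x : GB Q R m) : Coch k Q R (m + 1) := by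
  classical
  exact
    (∑ b : Q.A,
      if h : GBmem Q R (m + 1) (extL Q b x.val.1, extL Q b x.val.2) then
        Finsupp.single (⟨_, h⟩ : GB Q R (m + 1)) (1 : k) else 0)
    - ((-1 : k) ^ m) •
      (∑ a : Q.A,
        if h : Q.tgt a = psrc Q x.val.1 ∧
            GBmem Q R (m + 1) (extR Q a x.val.1, extR Q a x.val.2) then
          Finsupp.single (⟨_, h.2⟩ : GB Q R (m + 1)) (1 : k) else 0)

/-- The differential `d^m : k(Γ_m ∥ B) → k(Γ_{m+1} ∥ B)`. -/
noncomputable def dLin (k : Type) [Field k] (Q : Quiv) (R : Set (Q.A × Q.A)) (m : ℕ) :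
    Coch k Q R m →ₗ[k] Coch k Q R (m + 1) :=
  Finsupp.linearCombination k (dB k Q R m)

/-- The element `𝟙 = Σ_{i ∈ Q₀} (e_i, e_i)` (placed in degree `m`; it is the
intended element when `m = 0`). -/
noncomputable def oneD (k : Type) [Field k] (Q : Quiv) (R : Set (Q.A × Q.A)) (m : ℕ) :
    Coch k Q R m :=
  ∑ i : Q.V, bv k Q R m ((i, []), (i, []))

/-- `⟨α⟩ = Σ_{i=0}^{r-1} (s(rot^i α), rot^i α)`, `r` the period of `α`. -/
noncomputable def cycB (k : Type) [Field k] (Q : Quiv) (R : Set (Q.A × Q.A)) (m : ℕ)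
    (α : PathDat Q) : Coch k Q R m :=
  ∑ i ∈ Finset.range (periodP Q α),
    bv k Q R m ((psrc Q (rotI Q i α), []), rotI Q i α)

/-- `⟨C⟩ = Σ_{i=0}^{r-1} (-1)^{i m} (rot^i C, s(rot^i C))`, `r` the period of `C`. -/
noncomputable def cycG (k : Type) [Field k] (Q : Quiv) (R : Set (Q.A × Q.A)) (m : ℕ)
    (C : PathDat Q) : Coch k Q R m :=
  ∑ i ∈ Finset.range (periodP Q C),
    ((-1 : k) ^ (i * m)) • bv k Q R m (rotI Q i C, (psrc Q (rotI Q i C), []))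

/-- The coboundary subspace in degree `m` (zero in degree `0`). -/
noncomputable def cobSp (k : Type) [Field k] (Q : Quiv) (R : Set (Q.A × Q.A)) :
    (m : ℕ) → Submodule k (Coch k Q R m)
  | 0 => ⊥
  | m + 1 => LinearMap.range (dLin k Q R m)

/-- The cocycle subspace in degree `m`. -/
noncomputable def cocSp (k : Type) [Field k] (Q : Quiv) (R : Set (Q.A × Q.A)) (m : ℕ) :
    Submodule k (Coch k Q R m) :=
  LinearMap.ker (dLin k Q R m)

/-- The degree-`m` cohomology `HH^m` of the complex `k(Γ ∥ B)` vanishes: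
every cocycle is a coboundary. -/
def CohomIsZero (k : Type) [Field k] (Q : Quiv) (R : Set (Q.A × Q.A)) (m : ℕ) : Prop :=
  cocSp k Q R m ≤ cobSp k Q R m

/-- The degree-`m` cohomology `HH^m` of the complex `k(Γ ∥ B)` is
finite-dimensional: there is a finite set of cocycles whose classes span it. -/
def CohomFinDim (k : Type) [Field k] (Q : Quiv) (R : Set (Q.A × Q.A)) (m : ℕ) : Prop :=
  ∃ G : Finset (Coch k Q R m), ↑G ⊆ (cocSp k Q R m : Set (Coch k Q R m)) ∧
    cocSp k Q R m ≤ cobSp k Q R m ⊔ Submodule.span k ↑G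

/-- The degree-`m` cohomology `HH^m` of the complex `k(Γ ∥ B)` has dimension at
most `n`: there are `n` cocycles whose classes span it. -/
def CohomDimLe (k : Type) [Field k] (Q : Quiv) (R : Set (Q.A × Q.A)) (m n : ℕ) : Prop :=
  ∃ G : Finset (Coch k Q R m), G.card ≤ n ∧
    ↑G ⊆ (cocSp k Q R m : Set (Coch k Q R m)) ∧
    cocSp k Q R m ≤ cobSp k Q R m ⊔ Submodule.span k ↑G

/-- `Gen` is a basis of the kernel of `d⁰`, i.e. it freely generates `HH⁰`. -/
def FreelyGeneratesKer0 (k : Type) [Field k] (Q : Quiv) (R : Set (Q.A × Q.A))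
    (Gen : Set (Coch k Q R 0)) : Prop :=
  (∀ x ∈ Gen, dLin k Q R 0 x = 0) ∧
  (∀ z : Coch k Q R 0, dLin k Q R 0 z = 0 → z ∈ Submodule.span k Gen) ∧
  LinearIndependent k (fun x : Gen => (x : Coch k Q R 0))

/-- The cohomology classes of the elements of `Gen` freely generate the
degree-`(m+1)` cohomology of `k(Γ ∥ B)`: all elements of `Gen` are cocycles,
every cocycle is congruent to an element of their span modulo coboundaries, no
nonzero element of their span is a coboundary, and `Gen` is linearly
independent. -/
def FreelyGeneratesCohom (k : Type) [Field k] (Q : Quiv) (R : Set (Q.A × Q.A)) (m : ℕ)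
    (Gen : Set (Coch k Q R (m + 1))) : Prop :=
  (∀ x ∈ Gen, dLin k Q R (m + 1) x = 0) ∧
  (∀ z : Coch k Q R (m + 1), dLin k Q R (m + 1) z = 0 →
      ∃ y : Coch k Q R m, z - dLin k Q R m y ∈ Submodule.span k Gen) ∧
  (∀ x ∈ Submodule.span k Gen, x ∈ LinearMap.range (dLin k Q R m) → x = 0) ∧
  LinearIndependent k (fun x : Gen => (x : Coch k Q R (m + 1)))

/-! ### The chain complex `k(B ⊙ Γ)` -/

/-- Membership in the degree-`m` basis `B ⊙ Γ_m` of the chain complex. -/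
def BGmem (Q : Quiv) (R : Set (Q.A × Q.A)) (m : ℕ) (x : PathDat Q × PathDat Q) : Prop :=
  InB Q R x.1 ∧ InG Q R x.2 ∧ plen Q x.2 = m ∧ AntiPar Q x.1 x.2

abbrev BGt (Q : Quiv) (R : Set (Q.A × Q.A)) (m : ℕ) :=
  {x : PathDat Q × PathDat Q // BGmem Q R m x}

/-- The degree-`m` component of the chain complex `k(B ⊙ Γ)`. -/
abbrev Chn (k : Type) [Field k] (Q : Quiv) (R : Set (Q.A × Q.A)) (m : ℕ) :=
  BGt Q R m →₀ k

/-- The basis vector of `k(B ⊙ Γ_m)` attached to a raw pair of path data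
(and `0` if the pair is not in `B ⊙ Γ_m`). -/
noncomputable def bw (k : Type) [Field k] (Q : Quiv) (R : Set (Q.A × Q.A)) (m : ℕ)
    (x : PathDat Q × PathDat Q) : Chn k Q R m := by
  classical
  exact if h : BGmem Q R m x then Finsupp.single (⟨x, h⟩ : BGt Q R m) (1 : k) else 0

/-- `l1(p)`: the last arrow of `p` (as a path of length one). -/
def l1P (Q : Quiv) (p : PathDat Q) : PathDat Q :=
  match p.2.getLast? with
  | none => p
  | some a => (Q.src a, [a])

/-- `l2(p)`: `p` with its last arrow removed. -/
def l2P (Q : Quiv) (p : PathDat Q) : PathDat Q := (p.1, p.2.dropLast)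

/-- `r1(p)`: `p` with its first arrow removed. -/
def r1P (Q : Quiv) (p : PathDat Q) : PathDat Q :=
  match p.2 with
  | [] => p
  | a :: l => (Q.tgt a, l)

/-- `r2(p)`: the first arrow of `p` (as a path of length one). -/
def r2P (Q : Quiv) (p : PathDat Q) : PathDat Q :=
  match p.2 with
  | [] => p
  | a :: _ => (Q.src a, [a])

/-- The raw first term `(α·l1(γ), l2(γ))` of the boundary of `(α, γ)`. -/
def d1raw (Q : Quiv) (x : PathDat Q × PathDat Q) : PathDat Q × PathDat Q :=
  match x.2.2.getLast? with
  | none => x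
  | some a => ((Q.src a, a :: x.1.2), (x.2.1, x.2.2.dropLast))

/-- The raw second term `(r2(γ)·α, r1(γ))` of the boundary of `(α, γ)`. -/
def d2raw (Q : Quiv) (x : PathDat Q × PathDat Q) : PathDat Q × PathDat Q :=
  match x.2.2 with
  | [] => x
  | c :: l => ((x.1.1, x.1.2 ++ [c]), (Q.tgt c, l))

/-- The boundary of a basis element:
`d_m (α, γ) = (α·l1(γ), l2(γ)) + (-1)^m (r2(γ)·α, r1(γ))` (in degree `m = m+1`),
where pairs whose first component is not in `B` are interpreted as `0`. -/
noncomputable def bdB (k : Type) [Field k] (Q : Quiv) (R : Set (Q.A × Q.A)) (m : ℕ)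
    (x : BGt Q R (m + 1)) : Chn k Q R m :=
  bw k Q R m (d1raw Q x.val) + ((-1 : k) ^ (m + 1)) • bw k Q R m (d2raw Q x.val)

/-- The boundary map `d_{m+1} : k(B ⊙ Γ_{m+1}) → k(B ⊙ Γ_m)`. -/
noncomputable def bd (k : Type) [Field k] (Q : Quiv) (R : Set (Q.A × Q.A)) (m : ℕ) :
    Chn k Q R (m + 1) →ₗ[k] Chn k Q R m :=
  Finsupp.linearCombination k (bdB k Q R m)

/-- The subspace of cycles in degree `m` (everything in degree `0`). -/
noncomputable def ZSp (k : Type) [Field k] (Q : Quiv) (R : Set (Q.A × Q.A)) :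
    (m : ℕ) → Submodule k (Chn k Q R m)
  | 0 => ⊤
  | m + 1 => LinearMap.ker (bd k Q R m)

/-- The subspace of boundaries in degree `m`. -/
noncomputable def BSp (k : Type) [Field k] (Q : Quiv) (R : Set (Q.A × Q.A)) (m : ℕ) :
    Submodule k (Chn k Q R m) :=
  LinearMap.range (bd k Q R m)

/-- The degree-`m` homology `HH_m` of the complex `k(B ⊙ Γ)` vanishes:
every cycle is a boundary. -/
def HomIsZero (k : Type) [Field k] (Q : Quiv) (R : Set (Q.A × Q.A)) (m : ℕ) : Prop :=
  ZSp k Q R m ≤ BSp k Q R m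

/-- The degree-`m` homology `HH_m` of the complex `k(B ⊙ Γ)` is
finite-dimensional: there is a finite set of cycles whose classes span it. -/
def HomFinDim (k : Type) [Field k] (Q : Quiv) (R : Set (Q.A × Q.A)) (m : ℕ) : Prop :=
  ∃ G : Finset (Chn k Q R m), ↑G ⊆ (ZSp k Q R m : Set (Chn k Q R m)) ∧
    ZSp k Q R m ≤ BSp k Q R m ⊔ Submodule.span k ↑G

/-- The concatenation `α γ` of an antiparallel pair (a cycle, or a trivial path). -/
def concatP (Q : Quiv) (x : PathDat Q × PathDat Q) : PathDat Q := (x.2.1, x.2.2 ++ x.1.2)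

/-- The degree-`m` component of the subcomplex `k(B ⊙ Γ)_C`, spanned by the
basis elements whose concatenation lies in the circuit (rotation class) of `c`. -/
noncomputable def Wsp (k : Type) [Field k] (Q : Quiv) (R : Set (Q.A × Q.A))
    (c : PathDat Q) (m : ℕ) : Submodule k (Chn k Q R m) :=
  Submodule.span k {z : Chn k Q R m |
    ∃ x : BGt Q R m, RotEquiv Q (concatP Q x.val) c ∧ z = Finsupp.single x (1 : k)}

/-- The boundaries of the subcomplex `k(B ⊙ Γ)_C` in degree `m`. -/
noncomputable def WB (k : Type) [Field k] (Q : Quiv) (R : Set (Q.A × Q.A))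
    (c : PathDat Q) (m : ℕ) : Submodule k (Chn k Q R m) :=
  Submodule.map (bd k Q R m) (Wsp k Q R c (m + 1))

/-- The cycles of the subcomplex `k(B ⊙ Γ)_C` in degree `m`. -/
noncomputable def WZ (k : Type) [Field k] (Q : Quiv) (R : Set (Q.A × Q.A))
    (c : PathDat Q) (m : ℕ) : Submodule k (Chn k Q R m) :=
  ZSp k Q R m ⊓ Wsp k Q R c m

/-- The degree-`m` homology of `k(B ⊙ Γ)_C` is one-dimensional, spanned by the
homology class of `v`. -/
def SubHomSpannedBy (k : Type) [Field k] (Q : Quiv) (R : Set (Q.A × Q.A))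
    (c : PathDat Q) (m : ℕ) (v : Chn k Q R m) : Prop :=
  v ∈ WZ k Q R c m ∧ v ∉ WB k Q R c m ∧
  ∀ z ∈ WZ k Q R c m, ∃ t : k, z - t • v ∈ WB k Q R c m

/-- `ĥ(c) = Σ_{i=0}^{r-1} (r1(rot^i c), r2(rot^i c))` (degree 1, for cocomplete cycles;
placed in degree `m`). -/
noncomputable def hCycR (k : Type) [Field k] (Q : Quiv) (R : Set (Q.A × Q.A)) (m : ℕ)
    (c : PathDat Q) : Chn k Q R m :=
  ∑ i ∈ Finset.range (periodP Q c),
    bw k Q R m (r1P Q (rotI Q i c), r2P Q (rotI Q i c))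

/-- `ĥ(c) = Σ_{i=0}^{r-1} (-1)^{(m+1) i} (s(rot^i c), rot^i c)` (degree `m`, for
complete cycles of length `m`). -/
noncomputable def hCycM (k : Type) [Field k] (Q : Quiv) (R : Set (Q.A × Q.A)) (m : ℕ)
    (c : PathDat Q) : Chn k Q R m :=
  ∑ i ∈ Finset.range (periodP Q c),
    ((-1 : k) ^ ((m + 1) * i)) • bw k Q R m ((psrc Q (rotI Q i c), []), rotI Q i c)

/-- The homology classes of the elements of `Gen` freely generate the degree-`m`
homology of `k(B ⊙ Γ)`. -/
def FreelyGeneratesHom (k : Type) [Field k] (Q : Quiv) (R : Set (Q.A × Q.A)) (m : ℕ)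
    (Gen : Set (Chn k Q R m)) : Prop :=
  (∀ x ∈ Gen, x ∈ ZSp k Q R m) ∧
  (∀ z ∈ ZSp k Q R m, ∃ y : Chn k Q R (m + 1), z - bd k Q R m y ∈ Submodule.span k Gen) ∧
  (∀ x ∈ Submodule.span k Gen, x ∈ LinearMap.range (bd k Q R m) → x = 0) ∧
  LinearIndependent k (fun x : Gen => (x : Chn k Q R m))


section Helpers

variable {Q : Quiv} {R : Set (Q.A × Q.A)}

/-- The composability relation of `B`. -/
def ER (Q : Quiv) (R : Set (Q.A × Q.A)) (a b : Q.A) : Prop := Q.tgt a = Q.src b ∧ (a, b) ∉ R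

theorem isChain_and {α : Type} {r s : α → α → Prop} (l : List α) :
    List.IsChain (fun a b => r a b ∧ s a b) l ↔ List.IsChain r l ∧ List.IsChain s l := by
  induction l with
  | nil => simp
  | cons a l ih =>
    cases l with
    | nil => simp
    | cons b l =>
      simp only [List.isChain_cons_cons] at *
      tauto

theorem InB_iff (v : Q.V) (l : List Q.A) :
    InB Q R (v, l) ↔ List.IsChain (ER Q R) l ∧ ∀ a ∈ l.head?, Q.src a = v := by
  have := isChain_and (r := fun a b => Q.tgt a = Q.src b) (s := fun a b => (a, b) ∉ R) l
  unfold InB Ok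
  change (List.IsChain _ l ∧ _) ∧ List.IsChain _ l ↔ List.IsChain (fun a b => Q.tgt a = Q.src b ∧ (a, b) ∉ R) l ∧ _
  rw [this]
  tauto

theorem cocomplete_iff (v : Q.V) (l : List Q.A) :
    Cocomplete Q R (v, l) ↔
      l ≠ [] ∧ List.IsChain (ER Q R) (l ++ l) ∧ ∀ a ∈ l.head?, Q.src a = v := by
  unfold Cocomplete
  have h2 : powP Q (v, l) 2 = (v, l ++ l) := by simp [powP, powL]
  rw [h2, InB_iff]
  constructor
  · rintro ⟨⟨hok, hne, _⟩, hc, _⟩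
    exact ⟨hne, hc, hok.2⟩
  · rintro ⟨hne, hc, hs⟩
    have hch : List.IsChain (ER Q R) l := (List.isChain_append.1 hc).1
    refine ⟨⟨((InB_iff (R := R) v l).2 ⟨hch, hs⟩).1, hne, ?_⟩, hc, ?_⟩
    · have h3 := (List.isChain_append.1 hc).2.2
      obtain ⟨a, l', rfl⟩ := List.exists_cons_of_ne_nil hne
      have h4 := h3 ((a :: l').getLast hne) (List.getLast?_eq_some_getLast hne) a (by simp)
      have h5 := hs a (by simp)
      simp only [psrc, ptgt, List.getLast?_eq_some_getLast hne, Option.elim]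
      rw [h4.1, h5]
    · intro a ha
      apply hs
      obtain ⟨b, l', rfl⟩ := List.exists_cons_of_ne_nil hne
      simpa using ha

theorem rotP_concat (v : Q.V) (l : List Q.A) (a : Q.A) :
    rotP Q (v, l ++ [a]) = (Q.src a, a :: l) := by
  simp [rotP]

theorem cocomplete_swap (v : Q.V) (l : List Q.A) (a : Q.A) :
    Cocomplete Q R (v, l ++ [a]) → Cocomplete Q R (Q.src a, a :: l) := by
  rw [cocomplete_iff, cocomplete_iff]
  rintro ⟨_, h, _⟩
  refine ⟨by simp, ?_, by simp⟩
  have e : (l ++ [a]) ++ (l ++ [a]) = l ++ a :: (l ++ [a]) := by simp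
  rw [e, List.isChain_split] at h
  have h1 := h.2
  have e2 : (a :: l) ++ (a :: l) = (a :: l) ++ a :: l := rfl
  rw [List.isChain_split]
  refine ⟨by simpa using h1, ?_⟩
  exact List.IsChain.left_of_append (l₂ := [a]) (by simpa using h1)

theorem cocomplete_rotP {p : PathDat Q} (h : Cocomplete Q R p) : Cocomplete Q R (rotP Q p) := by
  obtain ⟨v, l⟩ := p
  rcases List.eq_nil_or_concat l with rfl | ⟨l', a, rfl⟩
  · simpa [rotP] using h
  · rw [List.concat_eq_append] at *
    rw [rotP_concat]
    exact cocomplete_swap v l' a h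

theorem cocomplete_rotI {p : PathDat Q} (h : Cocomplete Q R p) (i : ℕ) :
    Cocomplete Q R (rotI Q i p) := by
  unfold rotI
  induction i with
  | zero => exact h
  | succ n ih => rw [Function.iterate_succ_apply']; exact cocomplete_rotP ih

theorem rotP_iter_list (l2 : List Q.A) : ∀ (v : Q.V) (l1 : List Q.A),
    ((rotP Q)^[l2.length] (v, l1 ++ l2)).2 = l2 ++ l1 := by
  induction l2 using List.reverseRecOn with
  | nil => simp
  | append_singleton m a ih =>
    intro v l1
    rw [List.length_append, List.length_singleton, Function.iterate_succ_apply,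
      ← List.append_assoc, rotP_concat]
    have := ih (Q.src a) (a :: l1)
    simpa using this

theorem cocomplete_ext {p q : PathDat Q} (hp : Cocomplete Q R p) (hq : Cocomplete Q R q)
    (h : p.2 = q.2) : p = q := by
  obtain ⟨v, l⟩ := p
  obtain ⟨w, m⟩ := q
  simp only at h
  subst h
  rw [cocomplete_iff] at hp hq
  obtain ⟨a, l', rfl⟩ := List.exists_cons_of_ne_nil hp.1
  rw [← hp.2.2 a (by simp), ← hq.2.2 a (by simp)]

theorem cocomplete_periodic {p : PathDat Q} (h : Cocomplete Q R p) :
    p ∈ Function.periodicPts (rotP Q) := by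
  obtain ⟨v, l⟩ := p
  refine ⟨l.length, ?_, ?_⟩
  · exact List.length_pos_iff.2 ((cocomplete_iff v l).1 h).1
  · apply cocomplete_ext (R := R) (cocomplete_rotI h l.length) h
    simpa [rotI] using rotP_iter_list l v []

/-- Rotation orbits are symmetric. -/
theorem rot_symm {p q : PathDat Q} (h : Cocomplete Q R p) (hr : ∃ i, rotI Q i p = q) :
    ∃ i, rotI Q i q = p := by
  obtain ⟨i, rfl⟩ := hr
  obtain ⟨n, hn, hp⟩ := cocomplete_periodic h
  refine ⟨n * i - i, ?_⟩
  unfold rotI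
  rw [← Function.iterate_add_apply]
  have : n * i - i + i = n * i := Nat.sub_add_cancel (Nat.le_mul_of_pos_left i hn)
  rw [this]
  exact hp.mul_const i

theorem rot_trans {p q r : PathDat Q} (h : ∃ i, rotI Q i p = q) (h' : ∃ i, rotI Q i q = r) :
    ∃ i, rotI Q i p = r := by
  obtain ⟨i, rfl⟩ := h
  obtain ⟨j, rfl⟩ := h'
  exact ⟨j + i, by unfold rotI; rw [Function.iterate_add_apply]⟩

theorem periodP_eq {p : PathDat Q} (h : Cocomplete Q R p) :
    periodP Q p = Function.minimalPeriod (rotP Q) p := by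
  have hp := cocomplete_periodic h
  have hmem : Function.minimalPeriod (rotP Q) p ∈ {i : ℕ | 1 ≤ i ∧ rotI Q i p = p} :=
    ⟨Function.minimalPeriod_pos_of_mem_periodicPts hp, Function.iterate_minimalPeriod⟩
  apply le_antisymm
  · exact Nat.sInf_le hmem
  · have := Nat.sInf_mem ⟨_, hmem⟩
    exact Function.IsPeriodicPt.minimalPeriod_le this.1 this.2

/-! powers -/

theorem powL_add {α : Type} (l : List α) (m n : ℕ) : powL l (m + n) = powL l m ++ powL l n := by
  induction m with
  | zero => simp [powL]
  | succ m ih => rw [Nat.succ_add]; simp [powL, ih]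

theorem powL_mul {α : Type} (l : List α) (m n : ℕ) : powL (powL l m) n = powL l (m * n) := by
  induction n with
  | zero => simp [powL]
  | succ n ih =>
    change powL l m ++ powL (powL l m) n = _
    rw [ih, Nat.mul_succ, Nat.add_comm (m * n) m, powL_add]

theorem powL_comm {α : Type} (l : List α) (n : ℕ) : powL l n ++ l = powL l (n + 1) := by
  rw [powL_add]; simp [powL]

theorem cons_powL {α : Type} (l : List α) (a : α) (n : ℕ) :
    a :: powL (l ++ [a]) n = powL (a :: l) n ++ [a] := by
  induction n with
  | zero => simp [powL]
  | succ n ih => simp [powL, ih]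

theorem powP_mul (p : PathDat Q) (m n : ℕ) : powP Q (powP Q p m) n = powP Q p (m * n) := by
  simp [powP, powL_mul]

theorem rotP_powP (p : PathDat Q) (n : ℕ) (hp : p.2 ≠ []) :
    rotP Q (powP Q p (n + 1)) = powP Q (rotP Q p) (n + 1) := by
  obtain ⟨v, l⟩ := p
  rcases List.eq_nil_or_concat l with rfl | ⟨l', a, rfl⟩
  · exact absurd rfl hp
  · rw [List.concat_eq_append] at *
    rw [rotP_concat]
    unfold powP
    simp only
    rw [← powL_comm, ← List.append_assoc, rotP_concat, ← List.cons_append, cons_powL,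
      List.append_assoc, List.singleton_append, powL_comm]

theorem rotI_powP {p : PathDat Q} (h : Cocomplete Q R p) (n i : ℕ) :
    rotI Q i (powP Q p (n + 1)) = powP Q (rotI Q i p) (n + 1) := by
  unfold rotI
  induction i with
  | zero => rfl
  | succ i ih =>
    rw [Function.iterate_succ_apply', Function.iterate_succ_apply', ih, rotP_powP]
    exact (cocomplete_rotI h i).1.2.1

theorem head?_powL {α : Type} (l : List α) (n : ℕ) (hl : l ≠ []) :
    (powL l (n + 1)).head? = l.head? := by
  obtain ⟨b, l', rfl⟩ := List.exists_cons_of_ne_nil hl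
  simp [powL]

theorem isChain_powL {l : List Q.A} (hl : l ≠ []) (h : List.IsChain (ER Q R) (l ++ l)) (n : ℕ) :
    List.IsChain (ER Q R) (powL l n) := by
  have h' := List.isChain_append.1 h
  induction n with
  | zero => simp [powL]
  | succ n ih =>
    rw [powL, List.isChain_append]
    refine ⟨h'.1, ih, ?_⟩
    intro x hx y hy
    cases n with
    | zero => simp [powL] at hy
    | succ n =>
      rw [head?_powL _ _ hl] at hy
      exact h'.2.2 x hx y hy

theorem cocomplete_powP {p : PathDat Q} (h : Cocomplete Q R p) (n : ℕ) :
    Cocomplete Q R (powP Q p (n + 1)) := by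
  obtain ⟨v, l⟩ := p
  rw [cocomplete_iff] at h
  unfold powP
  rw [cocomplete_iff]
  simp only
  refine ⟨?_, ?_, ?_⟩
  · simp [powL, h.1]
  · rw [← powL_add]
    exact isChain_powL h.1 h.2.1 _
  · rw [head?_powL _ _ h.1]; exact h.2.2

theorem cocomplete_of_powP {p : PathDat Q} {n : ℕ} (hp : p.2 ≠ [])
    (h : Cocomplete Q R (powP Q p (n + 1))) : Cocomplete Q R p := by
  obtain ⟨v, l⟩ := p
  unfold powP at h
  rw [cocomplete_iff] at h
  rw [cocomplete_iff]
  simp only at h hp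
  rw [head?_powL _ _ hp] at h
  refine ⟨hp, ?_, h.2.2⟩
  have h1 := h.2.1
  rw [← powL_add] at h1
  have e : n + 1 + (n + 1) = 2 + 2 * n := by ring
  rw [e, powL_add] at h1
  simpa [powL] using (List.isChain_append.1 h1).1

theorem exists_primitive (N : ℕ) : ∀ p : PathDat Q, p.2.length ≤ N → IsCycle Q p →
    ∃ q n, IsPrimitive Q q ∧ p = powP Q q (n + 1) := by
  induction N with
  | zero =>
    intro p hp hc
    exact absurd (List.length_eq_zero_iff.1 (Nat.le_zero.1 hp)) hc.2.1
  | succ N ih =>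
    intro p hp hc
    by_cases hprim : IsPrimitive Q p
    · exact ⟨p, 0, hprim, by simp [powP, powL]⟩
    · have : ∃ q n, IsCycle Q q ∧ 2 ≤ n ∧ p = powP Q q n := by
        by_contra hcon
        push Not at hcon
        exact hprim ⟨hc, hcon⟩
      obtain ⟨q, n, hq, hn, rfl⟩ := this
      obtain ⟨m, rfl⟩ := Nat.exists_eq_add_of_le hn
      have hlen : q.2.length ≤ N := by
        have hpos := List.length_pos_iff.2 hq.2.1
        have : (powP Q q (2 + m)).2.length = q.2.length + (q.2.length + (powL q.2 m).length) := by
          rw [Nat.add_comm 2 m]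
          simp [powP, powL]
        omega
      obtain ⟨q', n', hq', rfl⟩ := ih q hlen hq
      refine ⟨q', (n' + 1) * (2 + m) - 1, hq', ?_⟩
      rw [powP_mul, Nat.sub_add_cancel]
      exact Nat.mul_pos (by omega) (by omega)

theorem exists_crep {S : Set (PathDat Q)} (hS : IsCrep Q S (Cocomplete Q R)) {p : PathDat Q}
    (h : Cocomplete Q R p) : ∃ α ∈ S, ∃ i, rotI Q i α = p := by
  obtain ⟨P, ⟨hP1, hP2⟩, rfl⟩ := hS
  obtain ⟨q, n, hq, rfl⟩ := exists_primitive _ p le_rfl h.1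
  have hqc : Cocomplete Q R q := cocomplete_of_powP hq.1.2.1 h
  obtain ⟨s, ⟨hs, hr⟩, _⟩ := hP2 q ⟨hq, hqc⟩
  refine ⟨powP Q s (n + 1), ⟨s, hs, n + 1, by omega, rfl⟩, ?_⟩
  obtain ⟨i, hi⟩ := rot_symm hqc hr
  exact ⟨i, by rw [rotI_powP (hP1 s hs).2, hi]⟩

theorem crep_cocomplete {S : Set (PathDat Q)} (hS : IsCrep Q S (Cocomplete Q R)) {p : PathDat Q}
    (h : p ∈ S) : Cocomplete Q R p := by
  obtain ⟨P, ⟨hP1, hP2⟩, rfl⟩ := hS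
  obtain ⟨s, hs, n, hn, rfl⟩ := h
  obtain ⟨m, rfl⟩ := Nat.exists_eq_add_of_le' hn
  exact cocomplete_powP (hP1 s hs).2 m

theorem cocomplete_of_bracket {v : Q.V} {b : Q.A} {l : List Q.A}
    (h : InB Q R (v, b :: (l ++ [b]))) :
    Cocomplete Q R (Q.src b, b :: l) ∧ Cocomplete Q R (Q.tgt b, l ++ [b]) := by
  rw [InB_iff] at h
  have h1 := h.1
  have h2 : List.IsChain (ER Q R) (b :: l) :=
    List.IsChain.left_of_append (l₂ := [b]) (by simpa using h1)
  have h3 : List.IsChain (ER Q R) (l ++ [b]) :=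
    List.IsChain.right_of_append (l₁ := [b]) (by simpa using h1)
  rw [cocomplete_iff, cocomplete_iff]
  refine ⟨⟨by simp, ?_, by simp⟩, by simp, ?_, ?_⟩
  · rw [List.isChain_split]
    exact ⟨by simpa using h1, h2⟩
  · have e : (l ++ [b]) ++ (l ++ [b]) = l ++ b :: (l ++ [b]) := by simp
    rw [e, List.isChain_split]
    exact ⟨h3, h1⟩
  · intro a ha
    rw [List.isChain_cons] at h1
    exact (h1.1 a ha).1.symm

theorem GBmem0_iff (v : Q.V) (p : PathDat Q) :
    GBmem Q R 0 ((v, []), p) ↔ InB Q R p ∧ v = p.1 ∧ p.1 = ptgt Q p := by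
  unfold GBmem Par InG Ok
  change (((List.IsChain _ [] ∧ _) ∧ List.IsChain _ []) ∧ _) ↔ _
  simp only [plen, psrc, List.isChain_nil, true_and, List.length_nil, and_true, List.head?_nil]
  have : ptgt Q (v, []) = v := rfl
  rw [this]
  constructor
  · rintro ⟨_, h1, h2, h3⟩
    exact ⟨h1, h2, h2 ▸ h3⟩
  · rintro ⟨h1, h2, h3⟩
    exact ⟨by simp, h1, h2, h2 ▸ h3⟩

theorem GBmem1_iff (b : Q.A) (l : List Q.A) :
    GBmem Q R 1 ((Q.src b, [b]), (Q.src b, l)) ↔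
      InB Q R (Q.src b, l) ∧ Q.tgt b = ptgt Q (Q.src b, l) := by
  unfold GBmem Par InG Ok
  change (((List.IsChain _ [b] ∧ _) ∧ List.IsChain _ [b]) ∧ _) ↔ _
  have : ptgt Q (Q.src b, [b]) = Q.tgt b := rfl
  rw [this]
  simp [plen, psrc]

theorem GB0_form (x : GB Q R 0) : x.val = ((x.val.2.1, []), x.val.2) := by
  obtain ⟨⟨⟨v, g⟩, p⟩, h⟩ := x
  have h1 : g = [] := List.length_eq_zero_iff.1 h.2.1
  have h2 : v = p.1 := h.2.2.2.1
  simp [h1, h2]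

theorem GB1_form (y : GB Q R 1) : ∃ b l, ∃ h : GBmem Q R 1 ((Q.src b, [b]), (Q.src b, l)),
    y = ⟨_, h⟩ := by
  obtain ⟨⟨⟨v, g⟩, ⟨w, l⟩⟩, h⟩ := y
  obtain ⟨b, rfl⟩ := List.length_eq_one_iff.1 h.2.1
  have h1 : Q.src b = v := h.1.1.2 b (by simp)
  have h2 : v = w := h.2.2.2.1
  subst h1
  subst h2
  exact ⟨b, l, h, rfl⟩

open Classical in
/-- The coefficient of a closed path in a degree `0` cochain, as a linear map. -/
noncomputable def cf (k : Type) [Field k] (Q : Quiv) (R : Set (Q.A × Q.A)) (p : PathDat Q) :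
    Coch k Q R 0 →ₗ[k] k :=
  if h : GBmem Q R 0 ((p.1, []), p) then Finsupp.lapply ⟨_, h⟩ else 0

variable {k : Type} [Field k]

theorem cf_self (z : Coch k Q R 0) (x : GB Q R 0) : cf k Q R x.val.2 z = z x := by
  have hx := GB0_form x
  have h : GBmem Q R 0 ((x.val.2.1, []), x.val.2) := hx ▸ x.2
  unfold cf
  rw [dif_pos h]
  change z _ = z _
  congr 1
  exact Subtype.ext hx.symm

theorem cf_ext {z w : Coch k Q R 0} (h : ∀ p, cf k Q R p z = cf k Q R p w) : z = w := by
  ext x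
  rw [← cf_self, ← cf_self, h]

theorem cf_not {p : PathDat Q} (h : ¬ (InB Q R p ∧ p.1 = ptgt Q p)) (z : Coch k Q R 0) :
    cf k Q R p z = 0 := by
  unfold cf
  rw [dif_neg]
  · rfl
  · rw [GBmem0_iff]; tauto

open Classical in
theorem cf_single (p : PathDat Q) (x : GB Q R 0) (a : k) :
    cf k Q R p (Finsupp.single x a) = if x.val.2 = p then a else 0 := by
  unfold cf
  split_ifs with h1 h2 h2
  · change (Finsupp.single x a) _ = _
    rw [Finsupp.single_apply, if_pos]
    apply Subtype.ext
    rw [GB0_form x, h2]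
  · change (Finsupp.single x a) _ = _
    rw [Finsupp.single_apply, if_neg]
    intro h
    exact h2 (by rw [h])
  · exact absurd (by rw [← h2, ← GB0_form x]; exact x.2) h1
  · rfl

open Classical in
theorem cf_bv (p α : PathDat Q) (hα : InB Q R α) (hc : α.1 = ptgt Q α) :
    cf k Q R p (bv k Q R 0 ((psrc Q α, []), α)) = if α = p then 1 else 0 := by
  have h : GBmem Q R 0 ((psrc Q α, []), α) := (GBmem0_iff _ _).2 ⟨hα, rfl, hc⟩
  unfold bv
  rw [dif_pos h, cf_single]

open Classical in
theorem dB_apply (x : GB Q R 0) (b : Q.A) (l : List Q.A)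
    (h : GBmem Q R 1 ((Q.src b, [b]), (Q.src b, l))) :
    dB k Q R 0 x ⟨_, h⟩ =
      (if l.getLast? = some b then (if x.val.2 = (Q.src b, l.dropLast) then 1 else 0) else 0) -
      (if l.head? = some b then (if x.val.2 = (Q.tgt b, l.tail) then 1 else 0) else 0) := by
  have hx := GB0_form x
  obtain ⟨⟨xv, ⟨v, m⟩⟩, hxm⟩ := x
  simp only at hx
  obtain ⟨rfl, _⟩ := Prod.ext_iff.1 hx
  unfold dB
  simp only [pow_zero, one_smul, Finsupp.sub_apply, Finsupp.finset_sum_apply]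
  congr 1
  · rw [Finset.sum_eq_single b]
    · split_ifs with h1 h2 h3 h3 h2 h3
      · rw [Finsupp.single_apply, if_pos]
        obtain ⟨rfl, rfl⟩ := Prod.ext_iff.1 h3
        apply Subtype.ext
        simp only [extL, List.nil_append]
        rw [List.dropLast_append_getLast? b h2]
      · rw [Finsupp.single_apply, if_neg]
        intro h4
        apply h3
        have h5 := congrArg (fun y => y.val.2) h4
        simp only [extL, Prod.mk.injEq] at h5
        rw [← h5.2, ← h5.1]; simp
      · rw [Finsupp.single_apply, if_neg]
        intro h4
        apply h2
        have h5 := congrArg (fun y => y.val.2) h4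
        simp only [extL, Prod.mk.injEq] at h5
        rw [← h5.2]; simp
      · exfalso
        apply h1
        obtain ⟨rfl, rfl⟩ := Prod.ext_iff.1 h2
        simp only [extL, List.nil_append]
        rw [List.dropLast_append_getLast? b h3]
        exact h
      · rfl
      · rfl
    · intro c _ hc
      split_ifs with h1
      · rw [Finsupp.single_apply, if_neg]
        intro h4
        have h5 := congrArg (fun y => y.val.1) h4
        simp [extL] at h5
        exact hc h5.2
      · rfl
    · simp
  · rw [Finset.sum_eq_single b]
    · split_ifs with h1 h2 h3 h3 h2 h3
      · rw [Finsupp.single_apply, if_pos]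
        obtain ⟨rfl, rfl⟩ := Prod.ext_iff.1 h3
        apply Subtype.ext
        simp only [extR]
        rw [List.cons_head?_tail h2]
      · rw [Finsupp.single_apply, if_neg]
        intro h4
        apply h3
        have h5 := congrArg (fun y => y.val.2) h4
        simp only [extR, Prod.mk.injEq] at h5
        rw [← h5.2, h1.1]; simp [psrc]
      · rw [Finsupp.single_apply, if_neg]
        intro h4
        apply h2
        have h5 := congrArg (fun y => y.val.2) h4
        simp only [extR, Prod.mk.injEq] at h5
        rw [← h5.2]; simp
      · exfalso
        apply h1
        obtain ⟨rfl, rfl⟩ := Prod.ext_iff.1 h2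
        simp only [extR, psrc]
        rw [List.cons_head?_tail h3]
        exact ⟨trivial, h⟩
      · rfl
      · rfl
    · intro c _ hc
      split_ifs with h1
      · rw [Finsupp.single_apply, if_neg]
        intro h4
        have h5 := congrArg (fun y => y.val.1) h4
        simp [extR] at h5
        exact hc h5.2
      · rfl
    · simp

theorem dLin_apply (z : Coch k Q R 0) (b : Q.A) (l : List Q.A)
    (h : GBmem Q R 1 ((Q.src b, [b]), (Q.src b, l))) :
    dLin k Q R 0 z ⟨_, h⟩ =
      (if l.getLast? = some b then cf k Q R (Q.src b, l.dropLast) z else 0) -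
      (if l.head? = some b then cf k Q R (Q.tgt b, l.tail) z else 0) := by
  classical
  induction z using Finsupp.induction_linear with
  | zero => simp
  | add f g hf hg =>
    rw [map_add, Finsupp.add_apply, hf, hg]
    simp only [map_add]
    split_ifs <;> ring
  | single x a =>
    unfold dLin
    rw [Finsupp.linearCombination_single, Finsupp.smul_apply, dB_apply]
    simp only [cf_single, smul_eq_mul]
    split_ifs <;> ring

theorem ker_iff (z : Coch k Q R 0) : dLin k Q R 0 z = 0 ↔
    ∀ b l, InB Q R (Q.src b, l) → Q.tgt b = ptgt Q (Q.src b, l) →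
      (if l.getLast? = some b then cf k Q R (Q.src b, l.dropLast) z else 0) =
      (if l.head? = some b then cf k Q R (Q.tgt b, l.tail) z else 0) := by
  constructor
  · intro hz b l h1 h2
    have h := (GBmem1_iff b l).2 ⟨h1, h2⟩
    have := dLin_apply z b l h
    rw [hz] at this
    exact (sub_eq_zero.1 this.symm)
  · intro hz
    ext y
    obtain ⟨b, l, h, rfl⟩ := GB1_form y
    rw [dLin_apply, hz b l ((GBmem1_iff b l).1 h).1 ((GBmem1_iff b l).1 h).2]
    simp

theorem ptgt_concat (v : Q.V) (l : List Q.A) (a : Q.A) : ptgt Q (v, l ++ [a]) = Q.tgt a := by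
  simp [ptgt]

theorem cocomplete_InB {p : PathDat Q} (h : Cocomplete Q R p) : InB Q R p ∧ p.1 = ptgt Q p := by
  refine ⟨?_, h.1.2.2⟩
  obtain ⟨v, l⟩ := p
  rw [cocomplete_iff] at h
  rw [InB_iff]
  exact ⟨(List.isChain_append.1 h.2.1).1, h.2.2⟩

theorem ker_vertex {z : Coch k Q R 0} (hz : dLin k Q R 0 z = 0) (b : Q.A) :
    cf k Q R (Q.src b, []) z = cf k Q R (Q.tgt b, []) z := by
  have := (ker_iff z).1 hz b [b] ((InB_iff _ _).2 ⟨by simp, by simp⟩) rfl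
  simpa using this

theorem ker_rotP {z : Coch k Q R 0} (hz : dLin k Q R 0 z = 0) {p : PathDat Q}
    (hp : Cocomplete Q R p) : cf k Q R (rotP Q p) z = cf k Q R p z := by
  obtain ⟨v, l⟩ := p
  rcases List.eq_nil_or_concat l with rfl | ⟨l', a, rfl⟩
  · rfl
  · rw [List.concat_eq_append] at *
    have h1 := ((cocomplete_iff _ _).1 hp).2.1
    have e : (l' ++ [a]) ++ (l' ++ [a]) = l' ++ a :: (l' ++ [a]) := by simp
    rw [e, List.isChain_split] at h1
    have h2 : InB Q R (Q.src a, a :: (l' ++ [a])) := (InB_iff _ _).2 ⟨h1.2, by simp⟩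
    have h3 := cocomplete_ext hp (cocomplete_of_bracket h2).2 rfl
    have h4 := (ker_iff z).1 hz a (a :: (l' ++ [a])) h2 (by
      rw [← List.cons_append, ptgt_concat])
    rw [rotP_concat, h3]
    have e1 : (a :: (l' ++ [a])).getLast? = some a := by
      rw [← List.cons_append, List.getLast?_concat]
    have e2 : (a :: (l' ++ [a])).dropLast = a :: l' := by
      rw [← List.cons_append, List.dropLast_concat]
    rw [if_pos e1, e2, if_pos (by simp)] at h4
    exact h4

theorem ker_rotI {z : Coch k Q R 0} (hz : dLin k Q R 0 z = 0) {p : PathDat Q}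
    (hp : Cocomplete Q R p) (i : ℕ) : cf k Q R (rotI Q i p) z = cf k Q R p z := by
  induction i with
  | zero => rfl
  | succ i ih =>
    rw [← ih]
    have := ker_rotP hz (cocomplete_rotI hp i)
    unfold rotI at *
    rw [Function.iterate_succ_apply']
    exact this

theorem ker_bmax {z : Coch k Q R 0} (hz : dLin k Q R 0 z = 0) {v : Q.V} {m : List Q.A}
    (hne : m ≠ []) (hB : InB Q R (v, m)) (hcl : v = ptgt Q (v, m))
    (hnc : ¬ Cocomplete Q R (v, m)) (hc : cf k Q R (v, m) z ≠ 0) : BMax Q R (v, m) := by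
  refine ⟨hB, ?_⟩
  rintro ⟨w, q⟩ hq ⟨s, t, hst⟩
  simp only at hst ⊢
  have hqc := ((InB_iff _ _).1 hq).1
  rw [← hst] at hqc
  have hmB := (InB_iff _ _).1 hB
  rcases t with _ | ⟨b, t⟩
  · rcases List.eq_nil_or_concat s with rfl | ⟨s, b, rfl⟩
    · simpa using hst
    · exfalso
      have hbm : List.IsChain (ER Q R) (b :: m) := by
        have e : s.concat b ++ m ++ [] = s ++ (b :: m) := by simp
        rw [e] at hqc
        exact hqc.right_of_append
      have h1 : InB Q R (Q.src b, b :: m) := (InB_iff _ _).2 ⟨hbm, by simp⟩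
      have htb : Q.tgt b = v := by
        obtain ⟨a, m', rfl⟩ := List.exists_cons_of_ne_nil hne
        rw [List.isChain_cons_cons] at hbm
        rw [← hmB.2 a (by simp)]
        exact hbm.1.1
      have h2 : Q.tgt b = ptgt Q (Q.src b, b :: m) := by
        rw [htb, hcl]
        rcases List.eq_nil_or_concat m with rfl | ⟨m', a, rfl⟩
        · exact absurd rfl hne
        · rw [List.concat_eq_append, ptgt_concat, ← List.cons_append, ptgt_concat]
      have h3 := (ker_iff z).1 hz b (b :: m) h1 h2
      rw [if_pos (by simp : (b :: m).head? = some b), if_neg] at h3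
      · rw [htb] at h3
        exact hc (by simpa using h3.symm)
      · intro h4
        rcases List.eq_nil_or_concat m with rfl | ⟨m', a, rfl⟩
        · exact absurd rfl hne
        · rw [List.concat_eq_append] at *
          rw [← List.cons_append] at h4
          simp only [List.getLast?_append, List.getLast?_singleton, Option.some_or,
            Option.some.injEq] at h4
          subst h4
          have := (cocomplete_of_bracket h1).2
          rw [htb] at this
          exact hnc this
  · exfalso
    have hmb : List.IsChain (ER Q R) (m ++ [b]) := by
      have e : s ++ m ++ b :: t = s ++ ((m ++ [b]) ++ t) := by simp
      rw [e] at hqc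
      exact hqc.right_of_append.left_of_append
    have hsb : Q.src b = v := by
      rcases List.eq_nil_or_concat m with rfl | ⟨m', a, rfl⟩
      · exact absurd rfl hne
      · rw [List.concat_eq_append] at *
        rw [ptgt_concat] at hcl
        rw [hcl]
        exact ((List.isChain_append.1 hmb).2.2 a (by simp) b (by simp)).1.symm
    have h1 : InB Q R (Q.src b, m ++ [b]) := by
      refine (InB_iff _ _).2 ⟨hmb, ?_⟩
      intro a ha
      obtain ⟨a', m', rfl⟩ := List.exists_cons_of_ne_nil hne
      rw [hsb]
      exact hmB.2 a (by simpa using ha)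
    have h3 := (ker_iff z).1 hz b (m ++ [b]) h1 (ptgt_concat _ _ _).symm
    rw [if_pos (by simp : (m ++ [b]).getLast? = some b), if_neg] at h3
    · rw [hsb] at h3
      exact hc (by simpa using h3)
    · intro h4
      obtain ⟨a', m', rfl⟩ := List.exists_cons_of_ne_nil hne
      simp only [List.cons_append, List.head?_cons, Option.some.injEq] at h4
      subst h4
      have := (cocomplete_of_bracket (by simpa using h1)).1
      rw [hsb] at this
      exact hnc this

open Classical in
theorem cf_oneD (p : PathDat Q) :
    cf k Q R p (oneD k Q R 0) = if p.2 = [] then 1 else 0 := by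
  unfold oneD
  rw [map_sum]
  have h : ∀ i : Q.V, cf k Q R p (bv k Q R 0 ((i, []), (i, []))) =
      if (i, ([] : List Q.A)) = p then (1 : k) else 0 := fun i =>
    cf_bv p (i, []) ((InB_iff _ _).2 ⟨by simp, by simp⟩) rfl
  simp only [h]
  obtain ⟨v, l⟩ := p
  by_cases hl : l = []
  · subst hl
    simp
  · simp [hl, Ne.symm hl]

open Classical in
theorem cf_cycB (p α : PathDat Q) (hα : Cocomplete Q R α) :
    cf k Q R p (cycB k Q R 0 α) = if ∃ i, rotI Q i α = p then 1 else 0 := by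
  unfold cycB
  rw [map_sum]
  have h : ∀ i, cf k Q R p (bv k Q R 0 ((psrc Q (rotI Q i α), []), rotI Q i α)) =
      if rotI Q i α = p then (1 : k) else 0 := fun i =>
    cf_bv p _ (cocomplete_InB (cocomplete_rotI hα i)).1 (cocomplete_InB (cocomplete_rotI hα i)).2
  simp only [h]
  rw [periodP_eq hα]
  have hpos := Function.minimalPeriod_pos_of_mem_periodicPts (cocomplete_periodic hα)
  split_ifs with hex
  · obtain ⟨i, rfl⟩ := hex
    rw [Finset.sum_eq_single (i % Function.minimalPeriod (rotP Q) α)]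
    · rw [if_pos]
      exact Function.iterate_mod_minimalPeriod_eq
    · intro j hj hne
      rw [if_neg]
      intro hij
      apply hne
      apply Function.iterate_injOn_Iio_minimalPeriod (f := rotP Q) (x := α)
        (Finset.mem_range.1 hj) (Nat.mod_lt _ hpos)
      change (rotP Q)^[j] α = (rotP Q)^[_] α
      rw [Function.iterate_mod_minimalPeriod_eq]
      exact hij
    · intro hn
      exact absurd (Finset.mem_range.2 (Nat.mod_lt _ hpos)) hn
  · apply Finset.sum_eq_zero
    intro i _
    rw [if_neg]
    intro hi
    exact hex ⟨i, hi⟩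

theorem oneD_ker : dLin k Q R 0 (oneD k Q R 0) = 0 := by
  classical
  rw [ker_iff]
  intro b l _ _
  simp only [cf_oneD]
  match l with
  | [] => simp
  | [a] => simp
  | a :: c :: l => simp

theorem bmax_ker {α : PathDat Q} (hα : BMax Q R α) (hc : α.1 = ptgt Q α) :
    dLin k Q R 0 (bv k Q R 0 ((psrc Q α, []), α)) = 0 := by
  classical
  rw [ker_iff]
  intro b l hl _
  simp only [cf_bv _ α hα.1 hc]
  trans 0
  · split_ifs with h1 h2
    · exfalso
      have h3 := hα.2 _ hl (by rw [h2]; exact (List.dropLast_prefix l).isInfix)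
      rw [h2] at h3
      simp only at h3
      have h4 := congrArg List.length h3
      rw [List.length_dropLast] at h4
      have : l = [] := List.length_eq_zero_iff.1 (by omega)
      simp [this] at h1
    · rfl
    · rfl
  · symm
    split_ifs with h1 h2
    · exfalso
      have h3 := hα.2 _ hl (by rw [h2]; exact (List.tail_suffix l).isInfix)
      rw [h2] at h3
      simp only at h3
      have h4 := congrArg List.length h3
      rw [List.length_tail] at h4
      have : l = [] := List.length_eq_zero_iff.1 (by omega)
      simp [this] at h1
    · rfl
    · rfl

theorem cycB_ker (hg : IsGentle Q R) {α : PathDat Q} (hα : Cocomplete Q R α) :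
    dLin k Q R 0 (cycB k Q R 0 α) = 0 := by
  classical
  rw [ker_iff]
  intro b l hl ht
  simp only [cf_cycB _ α hα, ← ite_and]
  congr 1
  -- the key step: `l = b δ b`
  have key : ∀ m, l = b :: (m ++ [b]) →
      ((∃ i, rotI Q i α = (Q.src b, b :: m)) ↔ (∃ i, rotI Q i α = (Q.tgt b, m ++ [b]))) := by
    intro m hm
    subst hm
    have hco := cocomplete_of_bracket hl
    have hrot : ∃ i, rotI Q i (Q.tgt b, m ++ [b]) = (Q.src b, b :: m) :=
      ⟨1, rotP_concat _ _ _⟩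
    exact ⟨fun h => rot_trans h (rot_symm hco.2 hrot), fun h => rot_trans h hrot⟩
  apply propext
  have hlc := ((InB_iff _ _).1 hl).1
  constructor
  · rintro ⟨h1, h2⟩
    have hl' := (List.dropLast_append_getLast? b h1).symm
    obtain ⟨i, hi⟩ := id h2
    have hco := cocomplete_rotI hα i
    rw [hi, cocomplete_iff] at hco
    generalize l.dropLast = m at *
    subst hl'
    obtain ⟨a, m', rfl⟩ := List.exists_cons_of_ne_nil hco.1
    have hla := (List.isChain_append.1 hco.2.1).2.2 _ (List.getLast?_eq_some_getLast hco.1) a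
      (by simp)
    have hlb := (List.isChain_append.1 hlc).2.2 _ (List.getLast?_eq_some_getLast hco.1) b
      (by simp)
    have hab : a = b := hg.uniqNotRelAfter _ hla hlb
    subst hab
    exact ⟨by simp, (key m' (by simp)).1 h2⟩
  · rintro ⟨h1, h2⟩
    have hl' := (List.cons_head?_tail h1).symm
    obtain ⟨i, hi⟩ := id h2
    have hco := cocomplete_rotI hα i
    rw [hi, cocomplete_iff] at hco
    generalize l.tail = m at *
    subst hl'
    rcases List.eq_nil_or_concat m with rfl | ⟨m', a, rfl⟩
    · exact absurd rfl hco.1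
    · rw [List.concat_eq_append] at *
      obtain ⟨f, m'', hf⟩ := List.exists_cons_of_ne_nil hco.1
      have hla := (List.isChain_append.1 hco.2.1).2.2 a (by simp) f (by rw [hf]; simp)
      rw [hf, List.isChain_cons_cons] at hlc
      have hab : a = b := hg.uniqNotRelBefore _ hla hlc.1
      subst hab
      refine ⟨by rw [← List.cons_append, List.getLast?_concat], ?_⟩
      have := (key m' rfl).2 h2
      rw [← List.cons_append, List.dropLast_concat]
      exact this

theorem span_step (G : Set (Coch k Q R 0)) (z g : Coch k Q R 0) (O : Set (PathDat Q))
    (x : GB Q R 0)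
    (hG : g ∈ G) (hz : dLin k Q R 0 z = 0) (hgk : dLin k Q R 0 g = 0)
    (hz0 : ∀ v, cf k Q R (v, []) z = 0) (hO : ∀ p ∈ O, cf k Q R p g = 1)
    (hO' : ∀ p ∉ O, cf k Q R p g = 0) (hne : ∀ p ∈ O, p.2 ≠ [])
    (hx : x ∈ z.support) (hxO : x.val.2 ∈ O) (hconst : ∀ p ∈ O, cf k Q R p z = z x)
    (ih : ∀ w : Coch k Q R 0, w.support.card < z.support.card → dLin k Q R 0 w = 0 →
      (∀ v, cf k Q R (v, []) w = 0) → w ∈ Submodule.span k G) :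
    z ∈ Submodule.span k G := by
  have hw : z - z x • g ∈ Submodule.span k G := by
    apply ih
    · apply Finset.card_lt_card
      rw [Finset.ssubset_iff_of_subset]
      · refine ⟨x, hx, ?_⟩
        rw [Finsupp.notMem_support_iff, ← cf_self, map_sub, map_smul, hO _ hxO, hconst _ hxO]
        simp
      · intro y hy
        rw [Finsupp.mem_support_iff, ← cf_self, map_sub, map_smul] at hy
        rw [Finsupp.mem_support_iff, ← cf_self]
        by_cases hyO : y.val.2 ∈ O
        · rw [hO _ hyO, hconst _ hyO] at hy
          simp at hy
        · rw [hO' _ hyO] at hy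
          simpa using hy
    · rw [map_sub, map_smul, hz, hgk]; simp
    · intro v
      rw [map_sub, map_smul, hz0, hO']
      · simp
      · intro h
        exact hne _ h rfl
  have := Submodule.add_mem _ hw (Submodule.smul_mem _ (z x) (Submodule.subset_span hG))
  simpa using this

theorem linInd_of_coord {G : Set (Coch k Q R 0)}
    (h : ∀ x ∈ G, ∃ p, cf k Q R p x ≠ 0 ∧ ∀ y ∈ G, cf k Q R p y ≠ 0 → y = x) :
    LinearIndependent k (fun x : G => (x : Coch k Q R 0)) := by
  rw [linearIndependent_iff']
  intro s c hs x hx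
  obtain ⟨p, h1, h2⟩ := h x x.2
  have h3 := congrArg (cf k Q R p) hs
  rw [map_sum, Finset.sum_eq_single x] at h3
  · simpa [h1] using h3
  · intro y _ hyx
    rw [map_smul]
    by_contra hcon
    apply hyx
    apply Subtype.ext
    apply h2 y y.2
    intro h0
    exact hcon (by rw [h0]; simp)
  · intro hn
    exact absurd hx hn

theorem bmax_not_cocomplete {p : PathDat Q} (h : BMax Q R p) : ¬ Cocomplete Q R p := by
  intro hc
  have h1 := h.2 _ hc.2 (by
    simp only [powP, powL]
    exact (List.prefix_append _ _).isInfix)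
  simp only [powP, powL, List.append_nil] at h1
  have h2 := congrArg List.length h1
  rw [List.length_append] at h2
  exact hc.1.2.1 (List.length_eq_zero_iff.1 (by omega))

/-- If a trivial path is `B`-maximal there is only one vertex. -/
theorem bmax_trivial (hg : IsGentle Q R) {α : PathDat Q} (h : BMax Q R α) (h0 : α.2 = []) :
    bv k Q R 0 ((psrc Q α, []), α) = oneD k Q R 0 := by
  have hA : ∀ b : Q.A, False := by
    intro b
    have h1 := h.2 (Q.src b, [b]) ((InB_iff _ _).2 ⟨by simp, by simp⟩) (by
      rw [h0]; exact List.nil_infix)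
    rw [h0] at h1
    simp at h1
  have hV : ∀ v w : Q.V, v = w := by
    intro v w
    have := hg.connected v w
    induction this with
    | refl => rfl
    | tail _ hadj _ => exact (hA hadj.choose).elim
  classical
  apply cf_ext
  intro p
  obtain ⟨v, l⟩ := α
  simp only at h0
  subst h0
  rw [cf_bv p _ h.1 rfl, cf_oneD]
  obtain ⟨w, m⟩ := p
  have : m = [] := by
    cases m with
    | nil => rfl
    | cons b _ => exact (hA b).elim
  subst this
  rw [hV v w]
  simp

theorem cycB_congr {α β : PathDat Q} (hα : Cocomplete Q R α) (hβ : Cocomplete Q R β)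
    (h : ∃ i, rotI Q i β = α) : cycB k Q R 0 β = cycB k Q R 0 α := by
  classical
  apply cf_ext
  intro p
  rw [cf_cycB _ _ hα, cf_cycB _ _ hβ]
  have : (∃ i, rotI Q i β = p) ↔ (∃ i, rotI Q i α = p) :=
    ⟨fun h' => rot_trans (rot_symm hβ h) h', fun h' => rot_trans h h'⟩
  simp only [this]

end Helpers

/-- For a gentle presentation `(Q, R)`, the kernel of
`d⁰ : k(Γ₀ ∥ B) → k(Γ₁ ∥ B)` (which is `HH⁰(kQ/⟨R⟩)`) is freely generated by:
the element `𝟙 = Σ_{i ∈ Q₀} (e_i, e_i)`, the pairs `(s(α), α)` in `Γ₀ ∥ B` with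
`α` a `B`-maximal path, and the sums `⟨α⟩` with `α ∈ Crep(B)`. -/
theorem hh0_basis (k : Type) [Field k] (Q : Quiv) (R : Set (Q.A × Q.A))
    (hg : IsGentle Q R) (S : Set (PathDat Q))
    (hS : IsCrep Q S (Cocomplete Q R)) :
    FreelyGeneratesKer0 k Q R
      ({oneD k Q R 0} ∪
       {x | ∃ α : PathDat Q, BMax Q R α ∧ GBmem Q R 0 ((psrc Q α, []), α) ∧
            x = bv k Q R 0 ((psrc Q α, []), α)} ∪
       {x | ∃ α ∈ S, x = cycB k Q R 0 α}) := by
  classical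
  refine ⟨?_, ?_, ?_⟩
  · rintro x ((rfl | ⟨α, hα, hm, rfl⟩) | ⟨α, hα, rfl⟩)
    · exact oneD_ker
    · exact bmax_ker hα ((GBmem0_iff _ _).1 hm).2.2
    · exact cycB_ker hg (crep_cocomplete hS hα)
  · set G := ({oneD k Q R 0} ∪
       {x | ∃ α : PathDat Q, BMax Q R α ∧ GBmem Q R 0 ((psrc Q α, []), α) ∧
            x = bv k Q R 0 ((psrc Q α, []), α)} ∪
       {x | ∃ α ∈ S, x = cycB k Q R 0 α}) with hG
    have main : ∀ n, ∀ z : Coch k Q R 0, z.support.card = n → dLin k Q R 0 z = 0 →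
        (∀ v, cf k Q R (v, []) z = 0) → z ∈ Submodule.span k G := by
      intro n
      induction n using Nat.strong_induction_on with
      | _ n ih =>
        intro z hn hz hz0
        rcases z.support.eq_empty_or_nonempty with he | ⟨x, hx⟩
        · rw [Finsupp.support_eq_empty.1 he]
          exact Submodule.zero_mem _
        have ih' : ∀ w : Coch k Q R 0, w.support.card < z.support.card →
            dLin k Q R 0 w = 0 → (∀ v, cf k Q R (v, []) w = 0) → w ∈ Submodule.span k G :=
          fun w hw h1 h2 => ih _ (hn ▸ hw) w rfl h1 h2
        have hxf := GB0_form x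
        have hxm : GBmem Q R 0 ((x.val.2.1, []), x.val.2) := hxf ▸ x.2
        have hxm' := (GBmem0_iff _ _).1 hxm
        have hxz : cf k Q R x.val.2 z ≠ 0 := by
          rw [cf_self]; exact Finsupp.mem_support_iff.1 hx
        have hxne : x.val.2.2 ≠ [] := by
          intro h
          apply hxz
          have : x.val.2 = (x.val.2.1, []) := by rw [← h]
          rw [this]
          exact hz0 _
        by_cases hco : Cocomplete Q R x.val.2
        · obtain ⟨α, hα, hr⟩ := exists_crep hS hco
          have hαc := crep_cocomplete hS hα
          refine span_step G z (cycB k Q R 0 α) {p | ∃ i, rotI Q i α = p} x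
            (Or.inr ⟨α, hα, rfl⟩) hz (cycB_ker hg hαc) hz0 ?_ ?_ ?_ hx hr ?_ ih'
          · intro p hp
            rw [cf_cycB _ _ hαc]
            exact if_pos hp
          · intro p hp
            rw [cf_cycB _ _ hαc]
            exact if_neg hp
          · rintro p ⟨i, rfl⟩
            exact (cocomplete_rotI hαc i).1.2.1
          · rintro p ⟨i, rfl⟩
            obtain ⟨j, hj⟩ := hr
            rw [← cf_self, ← hj, ker_rotI hz hαc, ker_rotI hz hαc]
        · have hmax : BMax Q R x.val.2 := ker_bmax hz hxne hxm'.1 hxm'.2.2 hco hxz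
          refine span_step G z (bv k Q R 0 ((psrc Q x.val.2, []), x.val.2)) {x.val.2} x
            (Or.inl (Or.inr ⟨x.val.2, hmax, hxm, rfl⟩)) hz (bmax_ker hmax hxm'.2.2) hz0
            ?_ ?_ ?_ hx rfl ?_ ih'
          · rintro p rfl
            rw [cf_bv _ _ hmax.1 hxm'.2.2, if_pos rfl]
          · intro p hp
            rw [cf_bv _ _ hmax.1 hxm'.2.2, if_neg (fun h => hp h.symm)]
          · rintro p rfl
            exact hxne
          · rintro p rfl
            exact cf_self _ _
    intro z hz
    obtain ⟨v0⟩ := hg.nonempty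
    have hconst : ∀ v, cf k Q R (v, []) z = cf k Q R (v0, []) z := by
      intro v
      have := hg.connected v0 v
      induction this with
      | refl => rfl
      | tail _ hadj ih =>
        rw [← ih]
        obtain ⟨b, ⟨rfl, rfl⟩ | ⟨rfl, rfl⟩⟩ := hadj
        · exact (ker_vertex hz b).symm
        · exact ker_vertex hz b
    have h1 := main _ (z - cf k Q R (v0, []) z • oneD k Q R 0) rfl
      (by rw [map_sub, map_smul, hz, oneD_ker]; simp)
      (by
        intro v
        rw [map_sub, map_smul, cf_oneD, hconst]
        simp)
    have h2 := Submodule.add_mem _ h1 (Submodule.smul_mem _ (cf k Q R (v0, []) z)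
      (Submodule.subset_span (s := G) (Or.inl (Or.inl rfl))))
    simpa using h2
  · apply linInd_of_coord
    rintro x ((rfl | ⟨α, hα, hm, rfl⟩) | ⟨α, hα, rfl⟩)
    · obtain ⟨v0⟩ := hg.nonempty
      refine ⟨(v0, []), by rw [cf_oneD]; simp, ?_⟩
      rintro y ((rfl | ⟨β, hβ, hm, rfl⟩) | ⟨β, hβ, rfl⟩) hy
      · rfl
      · rw [cf_bv _ _ hβ.1 ((GBmem0_iff _ _).1 hm).2.2] at hy
        have h : β = (v0, []) := by
          by_contra hcon
          exact hy (if_neg hcon)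
        exact bmax_trivial hg hβ (by rw [h])
      · have hβc := crep_cocomplete hS hβ
        rw [cf_cycB _ _ hβc] at hy
        have h : ∃ i, rotI Q i β = (v0, []) := by
          by_contra hcon
          exact hy (if_neg hcon)
        obtain ⟨i, hi⟩ := h
        have := (cocomplete_rotI hβc i).1.2.1
        rw [hi] at this
        exact absurd rfl this
    · have hm' := (GBmem0_iff _ _).1 hm
      refine ⟨α, by rw [cf_bv _ _ hα.1 hm'.2.2]; simp, ?_⟩
      rintro y ((rfl | ⟨β, hβ, hmβ, rfl⟩) | ⟨β, hβ, rfl⟩) hy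
      · rw [cf_oneD] at hy
        have h : α.2 = [] := by
          by_contra hcon
          exact hy (if_neg hcon)
        exact (bmax_trivial hg hα h).symm
      · rw [cf_bv _ _ hβ.1 ((GBmem0_iff _ _).1 hmβ).2.2] at hy
        have h : β = α := by
          by_contra hcon
          exact hy (if_neg hcon)
        rw [h]
      · have hβc := crep_cocomplete hS hβ
        rw [cf_cycB _ _ hβc] at hy
        have h : ∃ i, rotI Q i β = α := by
          by_contra hcon
          exact hy (if_neg hcon)
        obtain ⟨i, rfl⟩ := h
        exact absurd (cocomplete_rotI hβc i) (bmax_not_cocomplete hα)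
    · have hαc := crep_cocomplete hS hα
      refine ⟨α, ?_, ?_⟩
      · rw [cf_cycB _ _ hαc, if_pos ⟨0, rfl⟩]
        exact one_ne_zero
      rintro y ((rfl | ⟨β, hβ, hmβ, rfl⟩) | ⟨β, hβ, rfl⟩) hy
      · rw [cf_oneD, if_neg hαc.1.2.1] at hy
        exact absurd rfl hy
      · rw [cf_bv _ _ hβ.1 ((GBmem0_iff _ _).1 hmβ).2.2] at hy
        have h : β = α := by
          by_contra hcon
          exact hy (if_neg hcon)
        subst h
        exact absurd hαc (bmax_not_cocomplete hβ)
      · have hβc := crep_cocomplete hS hβ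
        rw [cf_cycB _ _ hβc] at hy
        have h : ∃ i, rotI Q i β = α := by
          by_contra hcon
          exact hy (if_neg hcon)
        exact cycB_congr hαc hβc h

end GentleTT
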